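/- Under the convexity and qualification assumptions, let (m₁,w,m₂,D) and (u,γ,P) be respectively solutions of (𝔓) and (𝔇). Let û = U[γ,P] and let π ∈ 𝛑[m₁,w,û,γ,P]. Then (m₁,π,û,γ,P) is a solution of the system (MFG). -/

import Mathlib

noncomputable section
open Finset Filter Topology Bornology
open scoped Classical Pointwise

/-- Fenchel conjugate of a function on a finite coordinate space. -/
def conjFn {d : Type*} [Fintype d] (g : (d → ℝ) → EReal) (y : d → ℝ) : EReal :=
  ⨆ x : d → ℝ, (↑(∑ i, x i * y i) : EReal) - g x

/-- Fenchel conjugate, scalar case. -/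
def conjR (g : ℝ → EReal) (y : ℝ) : EReal :=
  ⨆ x : ℝ, (↑(x * y) : EReal) - g x

/-- Subdifferential (empty where `g = ⊤`). -/
def subdiffFn {d : Type*} [Fintype d] (g : (d → ℝ) → EReal) (x : d → ℝ) : Set (d → ℝ) :=
  {p | g x ≠ ⊤ ∧ ∀ x', g x + (↑(∑ i, p i * (x' i - x i)) : EReal) ≤ g x'}

def subdiffR (g : ℝ → EReal) (x : ℝ) : Set ℝ :=
  {p | g x ≠ ⊤ ∧ ∀ x', g x + (↑(p * (x' - x)) : EReal) ≤ g x'}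

def EProper {E : Type*} (g : E → EReal) : Prop := (∃ x, g x ≠ ⊤) ∧ ∀ x, g x ≠ ⊥

def EConvexOn {E : Type*} [AddCommMonoid E] [SMul ℝ E] (g : E → EReal) : Prop :=
  ∀ x y : E, ∀ a b : ℝ, 0 ≤ a → 0 ≤ b → a + b = 1 →
    g (a • x + b • y) ≤ (a : EReal) * g x + (b : EReal) * g y

def EStrictConvexOn {E : Type*} [AddCommMonoid E] [SMul ℝ E] (g : E → EReal) : Prop :=
  ∀ x y : E, x ≠ y → g x ≠ ⊤ → g y ≠ ⊤ → ∀ a b : ℝ, 0 < a → 0 < b → a + b = 1 →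
    g (a • x + b • y) < (a : EReal) * g x + (b : EReal) * g y

/-- Perspective function. -/
def persp {d : Type*} [Fintype d] (h : (d → ℝ) → EReal) (θ : ℝ) (x : d → ℝ) : EReal :=
  if 0 < θ then (θ : EReal) * h (θ⁻¹ • x)
  else if θ = 0 ∧ x = 0 then 0 else ⊤

/-- The simplex `Δ(S)`. -/
def simplex (n : ℕ) : Set (Fin n → ℝ) :=
  {ρ | (∀ y, ρ y ∈ Set.Icc (0 : ℝ) 1) ∧ ∑ y, ρ y = 1}

abbrev Msp (T n : ℕ) := Fin (T + 1) → Fin n → ℝ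
abbrev Wsp (T n : ℕ) := Fin T → Fin n → Fin n → ℝ
abbrev Psp (T : ℕ) := Fin T → ℝ
abbrev Csp (T n : ℕ) := Msp T n × Wsp T n × Msp T n × Psp T
abbrev Ksp (T n : ℕ) := Msp T n × Msp T n × Psp T
abbrev LSp (T n : ℕ) := Fin T → Fin n → (Fin n → ℝ) → EReal
abbrev FSp (T n : ℕ) := Fin (T + 1) → (Fin n → ℝ) → EReal
abbrev PhiSp (T : ℕ) := Fin T → ℝ → EReal
abbrev ASp (T n : ℕ) := Fin T → Fin n → Fin n → ℝ

variable {T n : ℕ}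

def opA (α : ASp T n) (w : Wsp T n) (t : Fin T) : ℝ := ∑ x, ∑ y, w t x y * α t x y

def opS (w : Wsp T n) (s : Fin (T + 1)) (x : Fin n) : ℝ :=
  if h : (s : ℕ) = 0 then 0
  else ∑ y, w ⟨(s : ℕ) - 1, by have := s.isLt; omega⟩ y x

def mbar0 (m0 : Fin n → ℝ) (s : Fin (T + 1)) (x : Fin n) : ℝ := if s = 0 then m0 x else 0

def Qcpl (α : ASp T n) (m : Msp T n) (π : Wsp T n) (t : Fin T) : ℝ :=
  ∑ x, ∑ y, m t.castSucc x * π t x y * α t x y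

def IsKol (m0 : Fin n → ℝ) (π : Wsp T n) (m : Msp T n) : Prop :=
  (∀ x, m 0 x = m0 x) ∧
    ∀ (t : Fin T) (x : Fin n), m t.succ x = ∑ y, m t.castSucc y * π t y x

def InDelta (π : Wsp T n) : Prop := ∀ t x, π t x ∈ simplex n

def ConvAssumption (ℓ : LSp T n) (F : FSp T n) (φ : PhiSp T) : Prop :=
  (∀ t x, EProper (ℓ t x) ∧ EConvexOn (ℓ t x) ∧ LowerSemicontinuous (ℓ t x) ∧
    ∀ ρ, ℓ t x ρ ≠ ⊤ → ρ ∈ simplex n) ∧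
  (∀ s, EProper (F s) ∧ EConvexOn (F s) ∧ LowerSemicontinuous (F s)) ∧
  (∀ t, EProper (φ t) ∧ EConvexOn (φ t) ∧ LowerSemicontinuous (φ t))

def Jpot (ℓ : LSp T n) (F : FSp T n) (φ : PhiSp T) (α : ASp T n)
    (m : Msp T n) (π : Wsp T n) : EReal :=
  (∑ t, ∑ x, (↑(m t.castSucc x) : EReal) * ℓ t x (π t x)) +
    (∑ t, φ t (Qcpl α m π t)) + ∑ s, F s (m s)

def Jtil (ℓ : LSp T n) (F : FSp T n) (φ : PhiSp T) (α : ASp T n)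
    (m : Msp T n) (w : Wsp T n) : EReal :=
  (∑ t, ∑ x, persp (ℓ t x) (m t.castSucc x) (w t x)) +
    (∑ t, φ t (opA α w t)) + ∑ s, F s (m s)

def FeasP (m0 : Fin n → ℝ) (p : Msp T n × Wsp T n) : Prop := InDelta p.2 ∧ IsKol m0 p.2 p.1

def FeasPt (m0 : Fin n → ℝ) (p : Msp T n × Wsp T n) : Prop :=
  ∀ s x, opS p.2 s x - p.1 s x + mbar0 m0 s x = 0

def valP (ℓ : LSp T n) (F : FSp T n) (φ : PhiSp T) (α : ASp T n) (m0 : Fin n → ℝ) : EReal :=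
  ⨅ p ∈ {p : Msp T n × Wsp T n | FeasP m0 p}, Jpot ℓ F φ α p.1 p.2

def valPt (ℓ : LSp T n) (F : FSp T n) (φ : PhiSp T) (α : ASp T n) (m0 : Fin n → ℝ) : EReal :=
  ⨅ p ∈ {p : Msp T n × Wsp T n | FeasPt m0 p}, Jtil ℓ F φ α p.1 p.2

def IsSolP (ℓ : LSp T n) (F : FSp T n) (φ : PhiSp T) (α : ASp T n) (m0 : Fin n → ℝ)
    (p : Msp T n × Wsp T n) : Prop :=
  FeasP m0 p ∧ ∀ q, FeasP m0 q → Jpot ℓ F φ α p.1 p.2 ≤ Jpot ℓ F φ α q.1 q.2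

def IsSolPt (ℓ : LSp T n) (F : FSp T n) (φ : PhiSp T) (α : ASp T n) (m0 : Fin n → ℝ)
    (p : Msp T n × Wsp T n) : Prop :=
  FeasPt m0 p ∧ ∀ q, FeasPt m0 q → Jtil ℓ F φ α p.1 p.2 ≤ Jtil ℓ F φ α q.1 q.2

def dpCost (ℓ : LSp T n) (α : ASp T n) (u : Msp T n) (P : Psp T)
    (t : Fin T) (x : Fin n) : EReal :=
  conjFn (ℓ t x) (fun y => -(α t x y * P t + u t.succ y))

def FeasD (ℓ : LSp T n) (α : ASp T n) (k : Ksp T n) : Prop :=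
  (∀ t x, (↑(k.1 t.castSucc x) : EReal) + dpCost ℓ α k.1 k.2.2 t x ≤ ↑(k.2.1 t.castSucc x)) ∧
  ∀ x, k.1 (Fin.last T) x = k.2.1 (Fin.last T) x

def Dobj (F : FSp T n) (φ : PhiSp T) (m0 : Fin n → ℝ) (k : Ksp T n) : EReal :=
  (↑(∑ x, m0 x * k.1 0 x) : EReal) - (∑ t, conjR (φ t) (k.2.2 t)) -
    ∑ s, conjFn (F s) (k.2.1 s)

def valD (ℓ : LSp T n) (F : FSp T n) (φ : PhiSp T) (α : ASp T n) (m0 : Fin n → ℝ) : EReal :=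
  ⨆ k ∈ {k : Ksp T n | FeasD ℓ α k}, Dobj F φ m0 k

def IsSolD (ℓ : LSp T n) (F : FSp T n) (φ : PhiSp T) (α : ASp T n) (m0 : Fin n → ℝ)
    (k : Ksp T n) : Prop :=
  FeasD ℓ α k ∧ ∀ k', FeasD ℓ α k' → Dobj F φ m0 k' ≤ Dobj F φ m0 k

/-- `IsDP ℓ α γ P u` : `u = U[γ,P]`, i.e. `u` solves the dynamic programming equation. -/
def IsDP (ℓ : LSp T n) (α : ASp T n) (γ : Msp T n) (P : Psp T) (u : Msp T n) : Prop :=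
  (∀ (t : Fin T) (x : Fin n),
    (↑(u t.castSucc x) : EReal) + dpCost ℓ α u P t x = ↑(γ t.castSucc x)) ∧
  ∀ x, u (Fin.last T) x = γ (Fin.last T) x

def valDt (ℓ : LSp T n) (F : FSp T n) (φ : PhiSp T) (α : ASp T n) (m0 : Fin n → ℝ) : EReal :=
  ⨆ k ∈ {k : Ksp T n | IsDP ℓ α k.2.1 k.2.2 k.1}, Dobj F φ m0 k

def IsSolDt (ℓ : LSp T n) (F : FSp T n) (φ : PhiSp T) (α : ASp T n) (m0 : Fin n → ℝ)
    (γ : Msp T n) (P : Psp T) (u : Msp T n) : Prop :=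
  IsDP ℓ α γ P u ∧
    ∀ γ' P' u', IsDP ℓ α γ' P' u' → Dobj F φ m0 (u', γ', P') ≤ Dobj F φ m0 (u, γ, P)

def IsKolPert (m0 : Fin n → ℝ) (ε1 : Msp T n) (π : Wsp T n) (m1 : Msp T n) : Prop :=
  (∀ x, m1 0 x = mbar0 m0 (0 : Fin (T + 1)) x + ε1 0 x) ∧
  ∀ (t : Fin T) (x : Fin n), m1 t.succ x = (∑ y, m1 t.castSucc y * π t y x) - ε1 t.succ x

def qnorm (ε1 ε2 : Msp T n) (ε3 : Psp T) : ℝ :=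
  Real.sqrt ((∑ s, ∑ x, ε1 s x ^ 2) + (∑ s, ∑ x, ε2 s x ^ 2) + ∑ t, ε3 t ^ 2)

def Qualif (ℓ : LSp T n) (F : FSp T n) (φ : PhiSp T) (α : ASp T n) (m0 : Fin n → ℝ) : Prop :=
  ∃ α0 : ℝ, 0 < α0 ∧ ∀ (ε1 ε2 : Msp T n) (ε3 : Psp T), qnorm ε1 ε2 ε3 ≤ α0 →
    ∃ π : Wsp T n, (∀ t x, ℓ t x (π t x) ≠ ⊤) ∧
      ∃ m1 : Msp T n, IsKolPert m0 ε1 π m1 ∧ (∀ s x, 0 ≤ m1 s x) ∧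
        (∀ s, F s (fun x => m1 s x + ε2 s x) ≠ ⊤) ∧
        ∀ t, φ t (Qcpl α m1 π t + ε3 t) ≠ ⊤

def Fobj (ℓ : LSp T n) (F : FSp T n) (φ : PhiSp T) (c : Csp T n) : EReal :=
  (∑ t, ∑ x, persp (ℓ t x) (c.1 t.castSucc x) (c.2.1 t x)) +
    (∑ t, φ t (c.2.2.2 t)) + ∑ s, F s (c.2.2.1 s)

def Gobj (m0 : Fin n → ℝ) (k : Ksp T n) : EReal :=
  if (∀ s x, k.1 s x = -(mbar0 m0 s x)) ∧ k.2.1 = 0 ∧ k.2.2 = 0 then 0 else ⊤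

def Aop (α : ASp T n) (c : Csp T n) : Ksp T n :=
  (fun s x => opS c.2.1 s x - c.1 s x,
   fun s x => c.1 s x - c.2.2.1 s x,
   fun t => opA α c.2.1 t - c.2.2.2 t)

def AstarOp (α : ASp T n) (k : Ksp T n) : Csp T n :=
  (fun s x => k.2.1 s x - k.1 s x,
   fun t x y => α t x y * k.2.2 t + k.1 t.succ y,
   fun s x => -k.2.1 s x,
   fun t => -k.2.2 t)

def cpair (c c' : Csp T n) : ℝ :=
  (∑ s, ∑ x, c.1 s x * c'.1 s x) + (∑ t, ∑ x, ∑ y, c.2.1 t x y * c'.2.1 t x y) +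
    (∑ s, ∑ x, c.2.2.1 s x * c'.2.2.1 s x) + ∑ t, c.2.2.2 t * c'.2.2.2 t

def kpair (k k' : Ksp T n) : ℝ :=
  (∑ s, ∑ x, k.1 s x * k'.1 s x) + (∑ s, ∑ x, k.2.1 s x * k'.2.1 s x) +
    ∑ t, k.2.2 t * k'.2.2 t

def FobjStar (ℓ : LSp T n) (F : FSp T n) (φ : PhiSp T) (c' : Csp T n) : EReal :=
  ⨆ c : Csp T n, (↑(cpair c c') : EReal) - Fobj ℓ F φ c

def GobjStar (m0 : Fin n → ℝ) (k : Ksp T n) : EReal := ↑(-(∑ x, m0 x * k.1 0 x))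

def PfrakObj (ℓ : LSp T n) (F : FSp T n) (φ : PhiSp T) (α : ASp T n) (m0 : Fin n → ℝ)
    (c : Csp T n) : EReal := Fobj ℓ F φ c + Gobj m0 (Aop α c)

def DfrakObj (ℓ : LSp T n) (F : FSp T n) (φ : PhiSp T) (α : ASp T n) (m0 : Fin n → ℝ)
    (k : Ksp T n) : EReal := FobjStar ℓ F φ (-AstarOp α k) + GobjStar m0 k

def IsSolPfrak (ℓ : LSp T n) (F : FSp T n) (φ : PhiSp T) (α : ASp T n) (m0 : Fin n → ℝ)
    (c : Csp T n) : Prop := ∀ c', PfrakObj ℓ F φ α m0 c ≤ PfrakObj ℓ F φ α m0 c'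

def IsSolDfrak (ℓ : LSp T n) (F : FSp T n) (φ : PhiSp T) (α : ASp T n) (m0 : Fin n → ℝ)
    (k : Ksp T n) : Prop := ∀ k', DfrakObj ℓ F φ α m0 k ≤ DfrakObj ℓ F φ α m0 k'

def MFGi (ℓ : LSp T n) (α : ASp T n) (γ : Msp T n) (P : Psp T) (u : Msp T n) : Prop :=
  (∀ (t : Fin T) (x : Fin n), (↑(u t.castSucc x) : EReal) =
      ⨅ ρ ∈ simplex n,
        ℓ t x ρ + ↑(γ t.castSucc x) + ↑(∑ y, ρ y * (α t x y * P t + u t.succ y))) ∧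
  ∀ x, u (Fin.last T) x = γ (Fin.last T) x

def MFGii (ℓ : LSp T n) (α : ASp T n) (π : Wsp T n) (γ : Msp T n) (P : Psp T)
    (u : Msp T n) : Prop :=
  ∀ (t : Fin T) (x : Fin n),
    ℓ t x (π t x) + ↑(γ t.castSucc x) + ↑(∑ y, π t x y * (α t x y * P t + u t.succ y)) =
      (↑(u t.castSucc x) : EReal)

def IsMFGSol (ℓ : LSp T n) (F : FSp T n) (φ : PhiSp T) (α : ASp T n) (m0 : Fin n → ℝ)
    (m : Msp T n) (π : Wsp T n) (u : Msp T n) (γ : Msp T n) (P : Psp T) : Prop :=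
  InDelta π ∧ MFGi ℓ α γ P u ∧ MFGii ℓ α π γ P u ∧ IsKol m0 π m ∧
    (∀ s, γ s ∈ subdiffFn (F s) (m s)) ∧ ∀ t, P t ∈ subdiffR (φ t) (Qcpl α m π t)


/-- Membership in the set `𝛑[m,w,u,γ,P]` of admissible disintegrations:
`π ∈ Δ`, `π(t,x,·) = w(t,x,·)/m(t,x)` whenever `m(t,x) > 0` and `π(t,x,·)`
minimizes the individual cost whenever `m(t,x) = 0`. -/
def InPiSet {T n : ℕ} (ℓ : LSp T n) (α : ASp T n) (m : Msp T n) (w : Wsp T n)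
    (u : Msp T n) (P : Psp T) (π : Wsp T n) : Prop :=
  InDelta π ∧
  ∀ (t : Fin T) (x : Fin n),
    (0 < m t.castSucc x → ∀ y, π t x y = w t x y / m t.castSucc x) ∧
    (m t.castSucc x = 0 → ∀ ρ ∈ simplex n,
      ℓ t x (π t x) + ↑(∑ y, π t x y * (P t * α t x y + u t.succ y)) ≤
        ℓ t x ρ + ↑(∑ y, ρ y * (P t * α t x y + u t.succ y)))

/-- A convex subset of `V × ℝ` whose projection to `V` is absorbing and whose lowest point above
the origin is `(0, v)` lies above the graph of an affine function through `(0, v)`. -/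
lemma Convex.exists_linearMap_minorant {V : Type*} [AddCommGroup V] [Module ℝ V]
    {E : Set (V × ℝ)} (hE : Convex ℝ E) {v : ℝ} (hmem : ((0 : V), v) ∈ E)
    (hv : ∀ r, ((0 : V), r) ∈ E → v ≤ r)
    (habs : ∀ e : V, ∃ t : ℝ, 0 < t ∧ ∃ r, (t • e, r) ∈ E) :
    ∃ L : V →ₗ[ℝ] ℝ, ∀ p ∈ E, v ≤ p.2 + L p.1 := by
  let s : PointedCone ℝ (V × ℝ) :=
    { carrier := {p | ∃ t : ℝ, 0 < t ∧ (t • p.1, v + t * p.2) ∈ E}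
      zero_mem' := ⟨1, one_pos, by simpa using hmem⟩
      add_mem' := by
        rintro p q ⟨t, ht, hp⟩ ⟨t', ht', hq⟩
        have hs : 0 < t + t' := add_pos ht ht'
        refine ⟨t * t' / (t + t'), by positivity, ?_⟩
        have h := hE hp hq (a := t' / (t + t')) (b := t / (t + t')) (by positivity)
          (by positivity) (by field_simp; ring)
        convert h using 1
        ext
        · simp only [Prod.fst_add, Prod.smul_fst, smul_add, smul_smul]
          congr 2 <;> ring
        · simp only [Prod.snd_add, Prod.smul_snd, smul_eq_mul]
          field_simp
          ring
      smul_mem' := by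
        rintro ⟨a, ha⟩ p ⟨t, ht, hp⟩
        rcases ha.eq_or_lt with rfl | ha'
        · exact ⟨1, one_pos, by simpa [Subtype.ext_iff] using hmem⟩
        · refine ⟨t / a, by positivity, ?_⟩
          convert hp using 1
          ext
          · change (t / a) • a • p.1 = _
            rw [smul_smul, div_mul_cancel₀ _ ha'.ne']
          · change v + t / a * (a * p.2) = _
            field_simp }
  have hs : ∀ p, p ∈ s ↔ ∃ t : ℝ, 0 < t ∧ (t • p.1, v + t * p.2) ∈ E := fun _ => Iff.rfl
  let f : (V × ℝ) →ₗ.[ℝ] ℝ :=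
    ⟨LinearMap.ker (LinearMap.fst ℝ V ℝ), (LinearMap.snd ℝ V ℝ).comp (Submodule.subtype _)⟩
  have hf : ∀ x : f.domain, f x = (x : V × ℝ).2 := fun _ => rfl
  obtain ⟨g, hgf, hg⟩ := riesz_extension s f
    (by
      rintro ⟨⟨e, r⟩, he⟩ hx
      obtain rfl : e = 0 := he
      obtain ⟨t, ht, h⟩ := (hs _).1 hx
      rw [hf]
      have := hv (v + t * r) (by simpa using h)
      exact nonneg_of_mul_nonneg_right (by linarith) ht)
    (by
      rintro ⟨e, a⟩
      obtain ⟨t, ht, r, h⟩ := habs e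
      refine ⟨⟨(0, (r - v) / t - a), rfl⟩, (hs _).2 ⟨t, ht, ?_⟩⟩
      convert h using 1
      ext
      · simp
      · simp only [Prod.snd_add]
        field_simp
        ring)
  refine ⟨g.comp (LinearMap.inl ℝ V ℝ), fun p hp => ?_⟩
  have h1 : 0 ≤ g (p.1, p.2 - v) :=
    hg _ ((hs _).2 ⟨1, one_pos, by simpa using hp⟩)
  have h2 : g ((0 : V), p.2 - v) = p.2 - v := hgf ⟨((0 : V), p.2 - v), rfl⟩
  have h3 : g (p.1, p.2 - v) = g (p.1, 0) + g (0, p.2 - v) := by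
    rw [← map_add]; simp
  simp only [LinearMap.comp_apply, LinearMap.inl_apply]
  linarith

lemma EReal.coe_sum_real {ι : Type*} (s : Finset ι) (f : ι → ℝ) :
    ((∑ i ∈ s, f i : ℝ) : EReal) = ∑ i ∈ s, (f i : EReal) := by
  induction s using Finset.induction_on with
  | empty => simp
  | insert a s ha ih => rw [sum_insert ha, sum_insert ha, EReal.coe_add, ih]

lemma EReal.sum_ne_bot {ι : Type*} {s : Finset ι} {f : ι → EReal} (h : ∀ i ∈ s, f i ≠ ⊥) :
    ∑ i ∈ s, f i ≠ ⊥ := by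
  induction s using Finset.induction_on with
  | empty => simp
  | insert a s ha ih =>
    rw [sum_insert ha, EReal.add_ne_bot_iff]
    exact ⟨h a (mem_insert_self a s), ih fun i hi => h i (mem_insert_of_mem hi)⟩

lemma EReal.ne_top_of_sum_ne_top {ι : Type*} {s : Finset ι} {f : ι → EReal}
    (h : ∀ i ∈ s, f i ≠ ⊥) (hs : ∑ i ∈ s, f i ≠ ⊤) : ∀ i ∈ s, f i ≠ ⊤ := by
  intro i hi htop
  apply hs
  rw [← add_sum_erase s f hi, htop]
  exact EReal.top_add_of_ne_bot (EReal.sum_ne_bot fun j hj => h j (mem_of_mem_erase hj))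

lemma EConvexOn.le_coe {E : Type*} [AddCommMonoid E] [SMul ℝ E] {g : E → EReal}
    (hg : EConvexOn g) {x y : E} {r q a b : ℝ} (hx : g x ≤ r) (hy : g y ≤ q) (ha : 0 ≤ a)
    (hb : 0 ≤ b) (hab : a + b = 1) : g (a • x + b • y) ≤ ((a * r + b * q : ℝ) : EReal) := by
  refine (hg x y a b ha hb hab).trans ?_
  rw [EReal.coe_add, EReal.coe_mul, EReal.coe_mul]
  exact add_le_add (mul_le_mul_of_nonneg_left hx (EReal.coe_nonneg.2 ha))
    (mul_le_mul_of_nonneg_left hy (EReal.coe_nonneg.2 hb))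

section Perspective

variable {d : Type*} [Fintype d] {h : (d → ℝ) → EReal}

lemma persp_of_pos {θ : ℝ} (hθ : 0 < θ) (x : d → ℝ) :
    persp h θ x = (θ : EReal) * h (θ⁻¹ • x) := if_pos hθ

@[simp] lemma persp_zero : persp h 0 (0 : d → ℝ) = 0 := by simp [persp]

lemma persp_ne_bot (hh : ∀ x, h x ≠ ⊥) (θ : ℝ) (x : d → ℝ) : persp h θ x ≠ ⊥ := by
  unfold persp
  split_ifs with h1 h2
  · rw [EReal.mul_ne_bot]
    have := hh (θ⁻¹ • x)
    simp [this, h1.le]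
  · simp
  · simp

lemma pos_or_zero_of_persp_ne_top {θ : ℝ} {x : d → ℝ} (hp : persp h θ x ≠ ⊤) :
    0 < θ ∨ θ = 0 ∧ x = 0 := by
  by_contra! hc
  refine hp ?_
  unfold persp
  rw [if_neg hc.1.not_gt, if_neg fun h0 => hc.2 h0.1 h0.2]

lemma coe_mul_le_coe_iff {θ r : ℝ} (hθ : 0 < θ) (z : EReal) :
    (θ : EReal) * z ≤ r ↔ z ≤ ((r / θ : ℝ) : EReal) := by
  induction z with
  | bot => simp [EReal.coe_mul_bot_of_pos hθ]
  | top => simp [EReal.coe_mul_top_of_pos hθ]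
  | coe z =>
    rw [← EReal.coe_mul, EReal.coe_le_coe_iff, EReal.coe_le_coe_iff, le_div_iff₀ hθ, mul_comm]

lemma persp_smul_le {θ a r : ℝ} (ha : 0 < a) {x : d → ℝ} (hp : persp h θ x ≤ r) :
    persp h (a * θ) (a • x) ≤ ((a * r : ℝ) : EReal) := by
  rcases pos_or_zero_of_persp_ne_top (ne_top_of_le_ne_top (EReal.coe_ne_top r) hp) with
    hθ | ⟨rfl, rfl⟩
  · rw [persp_of_pos hθ, coe_mul_le_coe_iff hθ] at hp
    rw [persp_of_pos (mul_pos ha hθ), coe_mul_le_coe_iff (mul_pos ha hθ), smul_smul,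
      mul_inv_rev, inv_mul_cancel_right₀ ha.ne', mul_div_mul_left _ _ ha.ne']
    exact hp
  · rw [persp_zero] at hp
    rw [mul_zero, smul_zero, persp_zero]
    exact EReal.coe_nonneg.2 (mul_nonneg ha.le (EReal.coe_nonneg.1 hp))

lemma persp_add_le (hc : EConvexOn h) {θ θ' r r' : ℝ} {x x' : d → ℝ} (hp : persp h θ x ≤ r)
    (hp' : persp h θ' x' ≤ r') : persp h (θ + θ') (x + x') ≤ ((r + r' : ℝ) : EReal) := by
  rcases pos_or_zero_of_persp_ne_top (ne_top_of_le_ne_top (EReal.coe_ne_top r) hp) with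
    hθ | ⟨rfl, rfl⟩
  · rcases pos_or_zero_of_persp_ne_top (ne_top_of_le_ne_top (EReal.coe_ne_top r') hp') with
      hθ' | ⟨rfl, rfl⟩
    · have hs := add_pos hθ hθ'
      rw [persp_of_pos hθ, coe_mul_le_coe_iff hθ] at hp
      rw [persp_of_pos hθ', coe_mul_le_coe_iff hθ'] at hp'
      rw [persp_of_pos hs, coe_mul_le_coe_iff hs]
      have := hc.le_coe hp hp' (a := θ / (θ + θ')) (b := θ' / (θ + θ')) (by positivity)
        (by positivity) (by field_simp)
      convert this using 2
      · rw [smul_smul, smul_smul, smul_add]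
        congr 2 <;> field_simp
      · field_simp
    · rw [persp_zero] at hp'
      rw [add_zero, add_zero]
      refine hp.trans (EReal.coe_le_coe_iff.2 ?_)
      linarith [EReal.coe_nonneg.1 hp']
  · rw [persp_zero] at hp
    rw [zero_add, zero_add]
    refine hp'.trans (EReal.coe_le_coe_iff.2 ?_)
    linarith [EReal.coe_nonneg.1 hp]

lemma persp_le_of_combo (hc : EConvexOn h) {θ θ' r r' a b : ℝ} {x x' : d → ℝ} (ha : 0 ≤ a)
    (hb : 0 ≤ b) (hab : a + b = 1) (hp : persp h θ x ≤ r) (hp' : persp h θ' x' ≤ r') :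
    persp h (a * θ + b * θ') (a • x + b • x') ≤ ((a * r + b * r' : ℝ) : EReal) := by
  rcases ha.eq_or_lt with rfl | ha
  · obtain rfl : b = 1 := by linarith
    simpa using hp'
  rcases hb.eq_or_lt with rfl | hb
  · obtain rfl : a = 1 := by linarith
    simpa using hp
  exact persp_add_le hc (persp_smul_le ha hp) (persp_smul_le hb hp')

end Perspective

/-- `c` lies in the domain of `Fobj`, with the given real upper bounds on each of its terms. -/
def TermBound (ℓ : LSp T n) (F : FSp T n) (φ : PhiSp T) (c : Csp T n)
    (a : Fin T → Fin n → ℝ) (b : Fin T → ℝ) (d : Fin (T + 1) → ℝ) : Prop :=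
  (∀ t x, persp (ℓ t x) (c.1 t.castSucc x) (c.2.1 t x) ≤ (a t x : EReal)) ∧
    (∀ t, φ t (c.2.2.2 t) ≤ (b t : EReal)) ∧ ∀ s, F s (c.2.2.1 s) ≤ (d s : EReal)

def termSum (a : Fin T → Fin n → ℝ) (b : Fin T → ℝ) (d : Fin (T + 1) → ℝ) : ℝ :=
  (∑ t, ∑ x, a t x) + ∑ t, b t + ∑ s, d s

lemma coe_termSum (a : Fin T → Fin n → ℝ) (b : Fin T → ℝ) (d : Fin (T + 1) → ℝ) :
    (termSum a b d : EReal) =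
      (∑ t, ∑ x, (a t x : EReal)) + ∑ t, (b t : EReal) + ∑ s, (d s : EReal) := by
  simp only [termSum, EReal.coe_add, EReal.coe_sum_real]

lemma TermBound.fobj_le {ℓ : LSp T n} {F : FSp T n} {φ : PhiSp T} {c : Csp T n}
    {a : Fin T → Fin n → ℝ} {b : Fin T → ℝ} {d : Fin (T + 1) → ℝ}
    (h : TermBound ℓ F φ c a b d) : Fobj ℓ F φ c ≤ termSum a b d := by
  rw [coe_termSum]
  exact add_le_add (add_le_add
    (Finset.sum_le_sum fun t _ => Finset.sum_le_sum fun x _ => h.1 t x)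
    (Finset.sum_le_sum fun t _ => h.2.1 t)) (Finset.sum_le_sum fun s _ => h.2.2 s)

lemma fobj_ne_bot {ℓ : LSp T n} {F : FSp T n} {φ : PhiSp T} (hconv : ConvAssumption ℓ F φ)
    (c : Csp T n) : Fobj ℓ F φ c ≠ ⊥ := by
  refine EReal.add_ne_bot_iff.2 ⟨EReal.add_ne_bot_iff.2 ⟨?_, ?_⟩, ?_⟩
  · exact EReal.sum_ne_bot fun t _ => EReal.sum_ne_bot fun x _ =>
      persp_ne_bot (hconv.1 t x).1.2 _ _
  · exact EReal.sum_ne_bot fun t _ => (hconv.2.2 t).1.2 _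
  · exact EReal.sum_ne_bot fun s _ => (hconv.2.1 s).1.2 _

lemma fobj_terms_ne_top {ℓ : LSp T n} {F : FSp T n} {φ : PhiSp T}
    (hconv : ConvAssumption ℓ F φ) {c : Csp T n} (hc : Fobj ℓ F φ c ≠ ⊤) :
    (∀ t x, persp (ℓ t x) (c.1 t.castSucc x) (c.2.1 t x) ≠ ⊤) ∧
      (∀ t, φ t (c.2.2.2 t) ≠ ⊤) ∧ ∀ s, F s (c.2.2.1 s) ≠ ⊤ := by
  have h1 : ∀ t ∈ univ, ∀ x ∈ univ, persp (ℓ t x) (c.1 t.castSucc x) (c.2.1 t x) ≠ ⊥ :=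
    fun t _ x _ => persp_ne_bot (hconv.1 t x).1.2 _ _
  have h1' := fun t ht => EReal.sum_ne_bot (h1 t ht)
  have h2 : ∀ t ∈ univ, φ t (c.2.2.2 t) ≠ ⊥ := fun t _ => (hconv.2.2 t).1.2 _
  have h3 : ∀ s ∈ univ, F s (c.2.2.1 s) ≠ ⊥ := fun s _ => (hconv.2.1 s).1.2 _
  have hs1 := EReal.sum_ne_bot h1'
  have hs2 := EReal.sum_ne_bot h2
  obtain ⟨h12, hF⟩ := (EReal.add_ne_top_iff_ne_top₂ (EReal.add_ne_bot_iff.2 ⟨hs1, hs2⟩)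
    (EReal.sum_ne_bot h3)).1 hc
  obtain ⟨hl, hφ⟩ := (EReal.add_ne_top_iff_ne_top₂ hs1 hs2).1 h12
  refine ⟨fun t x => ?_, fun t => ?_, fun s => ?_⟩
  · exact EReal.ne_top_of_sum_ne_top (h1 t (mem_univ t))
      (EReal.ne_top_of_sum_ne_top h1' hl t (mem_univ t)) x (mem_univ x)
  · exact EReal.ne_top_of_sum_ne_top h2 hφ t (mem_univ t)
  · exact EReal.ne_top_of_sum_ne_top h3 hF s (mem_univ s)

lemma exists_terms_eq {ℓ : LSp T n} {F : FSp T n} {φ : PhiSp T} (hconv : ConvAssumption ℓ F φ)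
    {c : Csp T n} (hc : Fobj ℓ F φ c ≠ ⊤) :
    ∃ a b d, (∀ t x, persp (ℓ t x) (c.1 t.castSucc x) (c.2.1 t x) = ((a t x : ℝ) : EReal)) ∧
      (∀ t, φ t (c.2.2.2 t) = ((b t : ℝ) : EReal)) ∧
      (∀ s, F s (c.2.2.1 s) = ((d s : ℝ) : EReal)) ∧ Fobj ℓ F φ c = termSum a b d := by
  obtain ⟨h1, h2, h3⟩ := fobj_terms_ne_top hconv hc
  have e1 := fun t x => (EReal.coe_toReal (h1 t x) (persp_ne_bot (hconv.1 t x).1.2 _ _)).symm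
  have e2 := fun t => (EReal.coe_toReal (h2 t) ((hconv.2.2 t).1.2 _)).symm
  have e3 := fun s => (EReal.coe_toReal (h3 s) ((hconv.2.1 s).1.2 _)).symm
  refine ⟨_, _, _, e1, e2, e3, ?_⟩
  rw [coe_termSum]
  simp only [← e1, ← e2, ← e3]
  rfl

lemma TermBound.combo {ℓ : LSp T n} {F : FSp T n} {φ : PhiSp T} (hconv : ConvAssumption ℓ F φ)
    {c c' : Csp T n} {a a' : Fin T → Fin n → ℝ} {b b' : Fin T → ℝ} {d d' : Fin (T + 1) → ℝ}
    (h : TermBound ℓ F φ c a b d) (h' : TermBound ℓ F φ c' a' b' d') {p q : ℝ} (hp : 0 ≤ p)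
    (hq : 0 ≤ q) (hpq : p + q = 1) :
    TermBound ℓ F φ (p • c + q • c') (p • a + q • a') (p • b + q • b') (p • d + q • d') :=
  ⟨fun t x => persp_le_of_combo (hconv.1 t x).2.1 hp hq hpq (h.1 t x) (h'.1 t x),
    fun t => (hconv.2.2 t).2.1.le_coe (h.2.1 t) (h'.2.1 t) hp hq hpq,
    fun s => (hconv.2.1 s).2.1.le_coe (h.2.2 s) (h'.2.2 s) hp hq hpq⟩

lemma termSum_combo (a a' : Fin T → Fin n → ℝ) (b b' : Fin T → ℝ) (d d' : Fin (T + 1) → ℝ)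
    (p q : ℝ) : termSum (p • a + q • a') (p • b + q • b') (p • d + q • d') =
      p * termSum a b d + q * termSum a' b' d' := by
  simp only [termSum, Pi.add_apply, Pi.smul_apply, smul_eq_mul, sum_add_distrib, ← mul_sum]
  ring

@[simp] lemma opS_zero (w : Wsp T n) (x : Fin n) : opS w 0 x = 0 := by simp [opS]

@[simp] lemma opS_succ (w : Wsp T n) (t : Fin T) (x : Fin n) :
    opS w t.succ x = ∑ y, w t y x := by simp [opS]

@[simp] lemma mbar0_zero (m0 : Fin n → ℝ) (x : Fin n) :
    mbar0 m0 (0 : Fin (T + 1)) x = m0 x := if_pos rfl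

@[simp] lemma mbar0_succ (m0 : Fin n → ℝ) (t : Fin T) (x : Fin n) :
    mbar0 m0 t.succ x = 0 := if_neg (Fin.succ_ne_zero t)

lemma Aop_combo (α : ASp T n) (c c' : Csp T n) (p q : ℝ) :
    Aop α (p • c + q • c') = p • Aop α c + q • Aop α c' := by
  refine Prod.ext ?_ (Prod.ext ?_ ?_)
  · funext s x
    induction s using Fin.cases with
    | zero => simp [Aop]; ring
    | succ t => simp [Aop, sum_add_distrib, ← mul_sum]; ring
  · funext s x
    simp [Aop]; ring
  · funext t
    simp [Aop, opA, sum_add_distrib, add_mul, mul_assoc, ← mul_sum]; ring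

/-- The contribution of the state `(t, x)` to the Lagrangian, `ℓ`-term excluded. -/
def linTerm (α : ASp T n) (k : Ksp T n) (t : Fin T) (x : Fin n) (θ : ℝ) (w : Fin n → ℝ) : ℝ :=
  θ * (k.2.1 t.castSucc x - k.1 t.castSucc x) +
    ∑ y, w y * (α t x y * k.2.2 t + k.1 t.succ y)

def linSum (α : ASp T n) (k : Ksp T n) (c : Csp T n) : ℝ :=
  (∑ t, ∑ x, linTerm α k t x (c.1 t.castSucc x) (c.2.1 t x)) +
    (∑ x, c.1 (Fin.last T) x * (k.2.1 (Fin.last T) x - k.1 (Fin.last T) x)) -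
    (∑ t, k.2.2 t * c.2.2.2 t) - ∑ s, ∑ x, k.2.1 s x * c.2.2.1 s x

lemma kpair_Aop (α : ASp T n) (k : Ksp T n) (c : Csp T n) :
    kpair k (Aop α c) = linSum α k c := by
  have h1 : ∑ s, ∑ x, k.1 s x * opS c.2.1 s x =
      ∑ t : Fin T, ∑ x, ∑ y, c.2.1 t x y * k.1 t.succ y := by
    rw [Fin.sum_univ_succ]
    simp only [opS_zero, opS_succ, mul_zero, sum_const_zero, zero_add, mul_sum]
    refine sum_congr rfl fun t _ => ?_
    rw [sum_comm]
    exact sum_congr rfl fun x _ => sum_congr rfl fun y _ => mul_comm _ _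
  have h2 : ∑ t, k.2.2 t * opA α c.2.1 t =
      ∑ t : Fin T, ∑ x, ∑ y, c.2.1 t x y * (α t x y * k.2.2 t) := by
    simp only [opA, mul_sum]
    exact sum_congr rfl fun t _ => sum_congr rfl fun x _ => sum_congr rfl fun y _ => by ring
  have h3 : ∑ s, ∑ x, c.1 s x * (k.2.1 s x - k.1 s x) =
      (∑ t : Fin T, ∑ x, c.1 t.castSucc x * (k.2.1 t.castSucc x - k.1 t.castSucc x)) +
        ∑ x, c.1 (Fin.last T) x * (k.2.1 (Fin.last T) x - k.1 (Fin.last T) x) :=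
    Fin.sum_univ_castSucc _
  have h4 : kpair k (Aop α c) = ∑ s, ∑ x, k.1 s x * opS c.2.1 s x +
      ∑ t, k.2.2 t * opA α c.2.1 t + ∑ s, ∑ x, c.1 s x * (k.2.1 s x - k.1 s x) -
      (∑ t, k.2.2 t * c.2.2.2 t) - ∑ s, ∑ x, k.2.1 s x * c.2.2.1 s x := by
    simp only [kpair, Aop, mul_sub, sub_mul, sum_sub_distrib, mul_comm (c.1 _ _)]
    ring
  rw [h4, h1, h2, h3]
  simp only [linSum, linTerm, mul_add, sum_add_distrib]
  ring

lemma cpair_neg_AstarOp (α : ASp T n) (k : Ksp T n) (c : Csp T n) :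
    cpair c (-AstarOp α k) = -linSum α k c := by
  have h3 : ∑ s, ∑ x, c.1 s x * (k.2.1 s x - k.1 s x) =
      (∑ t : Fin T, ∑ x, c.1 t.castSucc x * (k.2.1 t.castSucc x - k.1 t.castSucc x)) +
        ∑ x, c.1 (Fin.last T) x * (k.2.1 (Fin.last T) x - k.1 (Fin.last T) x) :=
    Fin.sum_univ_castSucc _
  have h4 : cpair c (-AstarOp α k) = -(∑ s, ∑ x, c.1 s x * (k.2.1 s x - k.1 s x)) -
      (∑ t, ∑ x, ∑ y, c.2.1 t x y * (α t x y * k.2.2 t + k.1 t.succ y)) +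
      (∑ t, k.2.2 t * c.2.2.2 t) + ∑ s, ∑ x, k.2.1 s x * c.2.2.1 s x := by
    simp only [cpair, AstarOp, Prod.fst_neg, Prod.snd_neg, Pi.neg_apply, mul_neg, neg_neg,
      sum_neg_distrib, mul_comm (c.2.2.1 _ _), mul_comm (c.2.2.2 _)]
    ring
  rw [h4, h3]
  simp only [linSum, linTerm, sum_add_distrib]
  ring

lemma exists_matrix_repr {A B : Type*} [Fintype A] [Fintype B] (L : (A → B → ℝ) →ₗ[ℝ] ℝ) :
    ∃ K : A → B → ℝ, ∀ e, L e = ∑ a, ∑ b, K a b * e a b := by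
  refine ⟨fun a b => L (Pi.single a (Pi.single b 1)), fun e => ?_⟩
  have he : e = ∑ a, ∑ b, e a b • (Pi.single a (Pi.single b 1) : A → B → ℝ) := by
    funext a b
    simp [Finset.sum_apply, Pi.single_apply, ite_apply]
  conv_lhs => rw [he]
  simp only [map_sum, map_smul, smul_eq_mul, mul_comm]

lemma exists_vector_repr {A : Type*} [Fintype A] (L : (A → ℝ) →ₗ[ℝ] ℝ) :
    ∃ K : A → ℝ, ∀ e, L e = ∑ a, K a * e a := by
  refine ⟨fun a => L fun j => if a = j then 1 else 0, fun e => ?_⟩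
  rw [L.pi_apply_eq_sum_univ e]
  simp only [smul_eq_mul, mul_comm]

lemma exists_kpair_repr (L : Ksp T n →ₗ[ℝ] ℝ) : ∃ k, ∀ e, L e = kpair k e := by
  obtain ⟨u, hu⟩ := exists_matrix_repr (L.comp (LinearMap.inl ℝ _ _))
  obtain ⟨γ, hγ⟩ := exists_matrix_repr
    (L.comp ((LinearMap.inr ℝ _ _).comp (LinearMap.inl ℝ _ _)))
  obtain ⟨P, hP⟩ := exists_vector_repr
    (L.comp ((LinearMap.inr ℝ _ _).comp (LinearMap.inr ℝ _ _)))
  refine ⟨(u, γ, P), fun e => ?_⟩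
  have he : e = (e.1, 0, 0) + (0, e.2.1, 0) + (0, 0, e.2.2) := by simp
  conv_lhs => rw [he, map_add, map_add]
  exact congrArg₂ _ (congrArg₂ _ (hu e.1) (hγ e.2.1)) (hP e.2.2)

/-- The right-hand side `(m̄₀, 0, 0)` of the linear constraint. -/
def rhs (m0 : Fin n → ℝ) : Ksp T n := (mbar0 m0, 0, 0)

lemma kpair_add (k e e' : Ksp T n) : kpair k (e + e') = kpair k e + kpair k e' := by
  simp only [kpair, Prod.fst_add, Prod.snd_add, Pi.add_apply, mul_add, sum_add_distrib]
  ring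

lemma kpair_rhs (k : Ksp T n) (m0 : Fin n → ℝ) :
    kpair k (rhs m0) = ∑ x, m0 x * k.1 0 x := by
  simp [kpair, rhs, Fin.sum_univ_succ, mul_comm]

lemma Gobj_of_eq {m0 : Fin n → ℝ} {e : Ksp T n} (h : e + rhs m0 = 0) : Gobj m0 e = 0 := by
  obtain rfl := eq_neg_of_add_eq_zero_left h
  simp [Gobj, rhs]

lemma eq_of_Gobj_ne_top {m0 : Fin n → ℝ} {e : Ksp T n} (h : Gobj m0 e ≠ ⊤) :
    e + rhs m0 = 0 := by
  unfold Gobj at h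
  split_ifs at h with h1
  · obtain ⟨h1, h2, h3⟩ := h1
    refine Prod.ext ?_ (Prod.ext ?_ ?_)
    · funext s x
      simp [rhs, h1]
    · simp [rhs, h2]
    · simp [rhs, h3]
  · exact absurd rfl h

lemma Gobj_ne_bot (m0 : Fin n → ℝ) (e : Ksp T n) : Gobj m0 e ≠ ⊥ := by
  unfold Gobj
  split_ifs <;> simp

lemma qnorm_smul {t : ℝ} (ht : 0 ≤ t) (e₁ e₂ : Msp T n) (e₃ : Psp T) :
    qnorm (t • e₁) (t • e₂) (t • e₃) = t * qnorm e₁ e₂ e₃ := by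
  simp only [qnorm, Pi.smul_apply, smul_eq_mul, mul_pow, ← mul_sum, ← mul_add]
  rw [Real.sqrt_mul (sq_nonneg t), Real.sqrt_sq ht]

/-- Every small perturbation of the constraint is attained in the domain of `Fobj`. -/
lemma exists_perturbed_feasible {ℓ : LSp T n} {F : FSp T n} {φ : PhiSp T} {α : ASp T n}
    {m0 : Fin n → ℝ} (hconv : ConvAssumption ℓ F φ) (hqual : Qualif ℓ F φ α m0)
    (e : Ksp T n) : ∃ t : ℝ, 0 < t ∧
      ∃ c a b d, TermBound ℓ F φ c a b d ∧ Aop α c + rhs m0 = t • e := by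
  obtain ⟨r, hr, hq⟩ := hqual
  let e₁ : Msp T n := fun s x => if s = 0 then -e.1 s x else e.1 s x
  have hN : 0 ≤ qnorm e₁ (-e.2.1) (-e.2.2) := Real.sqrt_nonneg _
  set t := r / (qnorm e₁ (-e.2.1) (-e.2.2) + 1) with ht
  have htpos : 0 < t := by positivity
  obtain ⟨π, hπ, m, hm, hm0, hF, hφ⟩ := hq (t • e₁) (t • -e.2.1) (t • -e.2.2) (by
    rw [qnorm_smul htpos.le, ht, div_mul_eq_mul_div, div_le_iff₀ (by positivity)]
    nlinarith)
  have hℓ : ∀ t x, persp (ℓ t x) (m t.castSucc x) (m t.castSucc x • π t x) ≠ ⊤ := by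
    intro t x
    rcases (hm0 t.castSucc x).eq_or_lt with h | h
    · simp [← h]
    · rw [persp_of_pos h, inv_smul_smul₀ h.ne', EReal.mul_ne_top]
      have := (hconv.1 t x).1.2 (π t x)
      simp [hπ t x, h.le]
  refine ⟨t, htpos, (m, fun t x => m t.castSucc x • π t x,
    fun s x => m s x + (t • -e.2.1) s x, fun s => Qcpl α m π s + (t • -e.2.2) s),
    _, _, _, ⟨fun t x => EReal.le_coe_toReal (hℓ t x), fun t => EReal.le_coe_toReal (hφ t),
      fun s => EReal.le_coe_toReal (hF s)⟩, ?_⟩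
  refine Prod.ext ?_ (Prod.ext ?_ ?_)
  · funext s x
    induction s using Fin.cases with
    | zero => simp [Aop, rhs, hm.1, e₁]
    | succ s => simp [Aop, rhs, hm.2, e₁, Fin.succ_ne_zero]
  · funext s x
    simp [Aop, rhs]
  · funext s
    simp [Aop, rhs, opA, Qcpl]

lemma feasible_and_fobj_ne_top_of_solution {ℓ : LSp T n} {F : FSp T n} {φ : PhiSp T} {α : ASp T n}
    {m0 : Fin n → ℝ} (hconv : ConvAssumption ℓ F φ) (hqual : Qualif ℓ F φ α m0)
    {c : Csp T n} (hsol : IsSolPfrak ℓ F φ α m0 c) :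
    Aop α c + rhs m0 = 0 ∧ Fobj ℓ F φ c ≠ ⊤ := by
  obtain ⟨t, -, c', a, b, d, hc', h0⟩ := exists_perturbed_feasible hconv hqual (0 : Ksp T n)
  rw [smul_zero] at h0
  have h := hsol c'
  unfold PfrakObj at h
  rw [Gobj_of_eq h0, add_zero] at h
  have h1 := ne_top_of_le_ne_top (EReal.coe_ne_top _) (h.trans hc'.fobj_le)
  have h2 := (EReal.add_ne_top_iff_ne_top₂ (fobj_ne_bot hconv c) (Gobj_ne_bot _ _)).1 h1
  exact ⟨eq_of_Gobj_ne_top h2.2, h2.1⟩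

/-- Strong duality: a dual solution is a Lagrange multiplier for every primal solution. -/
lemma lagrangian_minimal {ℓ : LSp T n} {F : FSp T n} {φ : PhiSp T} {α : ASp T n}
    {m0 : Fin n → ℝ} (hconv : ConvAssumption ℓ F φ) (hqual : Qualif ℓ F φ α m0)
    {c : Csp T n} {k : Ksp T n} (hsol : IsSolPfrak ℓ F φ α m0 c)
    (hsolD : IsSolDfrak ℓ F φ α m0 k) {v : ℝ} (hv : Fobj ℓ F φ c = v) {c' : Csp T n}
    {a : Fin T → Fin n → ℝ} {b : Fin T → ℝ} {d : Fin (T + 1) → ℝ}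
    (hc' : TermBound ℓ F φ c' a b d) :
    v ≤ termSum a b d + kpair k (Aop α c' + rhs m0) := by
  obtain ⟨hc0, hctop⟩ := feasible_and_fobj_ne_top_of_solution hconv hqual hsol
  let E : Set (Ksp T n × ℝ) :=
    {p | ∃ c a b d, TermBound ℓ F φ c a b d ∧ Aop α c + rhs m0 = p.1 ∧ termSum a b d = p.2}
  have hE : Convex ℝ E := by
    rintro ⟨e, r⟩ ⟨c, a, b, d, h, rfl, rfl⟩ ⟨e', r'⟩ ⟨c', a', b', d', h', rfl, rfl⟩ p q hp hq hpq
    refine ⟨_, _, _, _, h.combo hconv h' hp hq hpq, ?_, termSum_combo a a' b b' d d' p q⟩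
    have : p • rhs (T := T) m0 + q • rhs m0 = rhs m0 := by rw [← add_smul, hpq, one_smul]
    change _ = p • (Aop α c + rhs m0) + q • (Aop α c' + rhs m0)
    rw [Aop_combo, smul_add, smul_add, add_add_add_comm, this]
  obtain ⟨L, hL⟩ := hE.exists_linearMap_minorant (v := v)
    (by
      obtain ⟨a, b, d, h1, h2, h3, h4⟩ := exists_terms_eq hconv hctop
      exact ⟨c, a, b, d, ⟨fun t x => (h1 t x).le, fun t => (h2 t).le, fun s => (h3 s).le⟩, hc0,
        EReal.coe_injective (h4.symm.trans hv)⟩)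
    (by
      rintro r ⟨c', a, b, d, h, h0, rfl⟩
      have := hsol c'
      unfold PfrakObj at this
      rw [Gobj_of_eq hc0, Gobj_of_eq h0, add_zero, add_zero, hv] at this
      exact EReal.coe_le_coe_iff.1 (this.trans h.fobj_le))
    (by
      intro e
      obtain ⟨t, ht, c, a, b, d, h, he⟩ := exists_perturbed_feasible hconv hqual e
      exact ⟨t, ht, _, c, a, b, d, h, he, rfl⟩)
  obtain ⟨k', hk'⟩ := exists_kpair_repr L
  have hD' : FobjStar ℓ F φ (-AstarOp α k') ≤ ((kpair k' (rhs m0) - v : ℝ) : EReal) := by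
    refine iSup_le fun c' => ?_
    by_cases htop : Fobj ℓ F φ c' = ⊤
    · simp [htop]
    obtain ⟨a, b, d, h1, h2, h3, h4⟩ := exists_terms_eq hconv htop
    have := hL (Aop α c' + rhs m0, termSum a b d) ⟨c', a, b, d,
      ⟨fun t x => (h1 t x).le, fun t => (h2 t).le, fun s => (h3 s).le⟩, rfl, rfl⟩
    rw [hk', kpair_add, kpair_Aop] at this
    rw [h4, cpair_neg_AstarOp, ← EReal.coe_sub, EReal.coe_le_coe_iff]
    linarith
  have hD : DfrakObj ℓ F φ α m0 k ≤ ((-v : ℝ) : EReal) := by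
    refine (hsolD k').trans ?_
    unfold DfrakObj GobjStar
    refine (add_le_add hD' le_rfl).trans ?_
    rw [← EReal.coe_add, EReal.coe_le_coe_iff, kpair_rhs]
    linarith
  have h1 : (cpair c' (-AstarOp α k) : EReal) - (termSum a b d : EReal) ≤
      FobjStar ℓ F φ (-AstarOp α k) :=
    (EReal.sub_le_sub le_rfl hc'.fobj_le).trans
      (le_iSup (fun c' => (cpair c' (-AstarOp α k) : EReal) - Fobj ℓ F φ c') c')
  have h2 := (add_le_add h1 (le_refl (GobjStar m0 k))).trans hD
  rw [GobjStar, ← EReal.coe_sub, ← EReal.coe_add, EReal.coe_le_coe_iff,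
    cpair_neg_AstarOp] at h2
  rw [kpair_add, kpair_Aop, kpair_rhs]
  linarith

lemma le_of_sum_le_sum {ι : Type*} [Fintype ι] {f g : ι → ℝ} (i : ι) (h : ∑ j, f j ≤ ∑ j, g j)
    (hle : ∀ j, j ≠ i → g j ≤ f j) : f i ≤ g i := by
  by_contra! hlt
  refine absurd (Finset.sum_lt_sum (fun j _ => ?_) ⟨i, mem_univ i, hlt⟩) h.not_gt
  by_cases hj : j = i
  · exact hj ▸ hlt.le
  · exact hle j hj

/-- `c`, with term values bounded by `a, b, d`, minimizes the Lagrangian with multiplier `k`. -/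
def LagrangeMin (ℓ : LSp T n) (F : FSp T n) (φ : PhiSp T) (α : ASp T n) (k : Ksp T n)
    (c : Csp T n) (a : Fin T → Fin n → ℝ) (b : Fin T → ℝ) (d : Fin (T + 1) → ℝ) : Prop :=
  TermBound ℓ F φ c a b d ∧ ∀ c' a' b' d', TermBound ℓ F φ c' a' b' d' →
    termSum a b d + linSum α k c ≤ termSum a' b' d' + linSum α k c'

section LagrangeMin

variable {ℓ : LSp T n} {F : FSp T n} {φ : PhiSp T} {α : ASp T n} {k : Ksp T n} {c : Csp T n}
  {a : Fin T → Fin n → ℝ} {b : Fin T → ℝ} {d : Fin (T + 1) → ℝ}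

lemma LagrangeMin.congestion_le (h : LagrangeMin ℓ F φ α k c a b d) (s : Fin (T + 1))
    {x' : Fin n → ℝ} {r : ℝ} (hr : F s x' ≤ r) :
    d s - ∑ x, k.2.1 s x * c.2.2.1 s x ≤ r - ∑ x, k.2.1 s x * x' x := by
  have h1 := h.2 (c.1, c.2.1, Function.update c.2.2.1 s x', c.2.2.2) a b
    (Function.update d s r) ⟨h.1.1, h.1.2.1, fun s' => by
      by_cases hs : s' = s
      · subst hs; simpa using hr
      · simpa [hs] using h.1.2.2 s'⟩
  have h2 := le_of_sum_le_sum s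
    (f := fun s' => d s' - ∑ x, k.2.1 s' x * c.2.2.1 s' x)
    (g := fun s' => Function.update d s r s' -
      ∑ x, k.2.1 s' x * Function.update c.2.2.1 s x' s' x)
    (by
      simp only [sum_sub_distrib]
      simp only [termSum, linSum] at h1
      linarith)
    (fun s' hs => by simp [hs])
  simpa using h2

lemma LagrangeMin.price_le (h : LagrangeMin ℓ F φ α k c a b d) (t : Fin T) {z r : ℝ}
    (hr : φ t z ≤ r) : b t - k.2.2 t * c.2.2.2 t ≤ r - k.2.2 t * z := by
  have h1 := h.2 (c.1, c.2.1, c.2.2.1, Function.update c.2.2.2 t z) a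
    (Function.update b t r) d ⟨h.1.1, fun t' => by
      by_cases ht : t' = t
      · subst ht; simpa using hr
      · simpa [ht] using h.1.2.1 t', h.1.2.2⟩
  have h2 := le_of_sum_le_sum t (f := fun t' => b t' - k.2.2 t' * c.2.2.2 t')
    (g := fun t' => Function.update b t r t' - k.2.2 t' * Function.update c.2.2.2 t z t')
    (by
      simp only [sum_sub_distrib]
      simp only [termSum, linSum] at h1
      linarith)
    (fun t' ht => by simp [ht])
  simpa using h2

lemma LagrangeMin.terminal_eq (h : LagrangeMin ℓ F φ α k c a b d) (x : Fin n) :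
    k.1 (Fin.last T) x = k.2.1 (Fin.last T) x := by
  have key : ∀ θ : ℝ, c.1 (Fin.last T) x * (k.2.1 (Fin.last T) x - k.1 (Fin.last T) x) ≤
      θ * (k.2.1 (Fin.last T) x - k.1 (Fin.last T) x) := by
    intro θ
    let m : Msp T n := fun s y => if s = Fin.last T ∧ y = x then θ else c.1 s y
    have hm : ∀ (t : Fin T) y, m t.castSucc y = c.1 t.castSucc y := fun t y =>
      if_neg fun h0 => (Fin.castSucc_lt_last t).ne h0.1
    have h1 := h.2 (m, c.2) a b d
      ⟨fun t y => by simpa only [hm] using h.1.1 t y, h.1.2.1, h.1.2.2⟩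
    have h2 := le_of_sum_le_sum x
      (f := fun y => c.1 (Fin.last T) y * (k.2.1 (Fin.last T) y - k.1 (Fin.last T) y))
      (g := fun y => m (Fin.last T) y * (k.2.1 (Fin.last T) y - k.1 (Fin.last T) y))
      (by
        simp only [termSum, linSum, hm] at h1
        linarith)
      (fun y hy => by simp [m, hy])
    simpa [m] using h2
  have h1 := key (c.1 (Fin.last T) x + 1)
  have h2 := key (c.1 (Fin.last T) x - 1)
  linarith

lemma LagrangeMin.state_le (h : LagrangeMin ℓ F φ α k c a b d) (t : Fin T) (x : Fin n) {θ r : ℝ}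
    {ω : Fin n → ℝ} (hr : persp (ℓ t x) θ ω ≤ r) :
    a t x + linTerm α k t x (c.1 t.castSucc x) (c.2.1 t x) ≤ r + linTerm α k t x θ ω := by
  let m : Msp T n := fun s y => if s = t.castSucc ∧ y = x then θ else c.1 s y
  let w : Wsp T n := fun t' y => if t' = t ∧ y = x then ω else c.2.1 t' y
  let a' : Fin T → Fin n → ℝ := fun t' y => if t' = t ∧ y = x then r else a t' y
  have hlast : ∀ y, m (Fin.last T) y = c.1 (Fin.last T) y := fun y =>
    if_neg fun h0 => (Fin.castSucc_lt_last t).ne' h0.1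
  have h1 := h.2 (m, w, c.2.2) a' b d ⟨fun t' y => by
      by_cases hty : t' = t ∧ y = x
      · obtain ⟨rfl, rfl⟩ := hty
        simpa [m, w, a'] using hr
      · simpa [m, w, a', hty] using h.1.1 t' y, h.1.2.1, h.1.2.2⟩
  have h2 := le_of_sum_le_sum t
    (f := fun t' => ∑ y, (a t' y + linTerm α k t' y (c.1 t'.castSucc y) (c.2.1 t' y)))
    (g := fun t' => ∑ y, (a' t' y + linTerm α k t' y (m t'.castSucc y) (w t' y)))
    (by
      simp only [sum_add_distrib]
      simp only [termSum, linSum, hlast] at h1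
      linarith)
    (fun t' ht => by simp [m, w, a', ht])
  have h3 := le_of_sum_le_sum x h2 (fun y hy => by simp [m, w, a', hy])
  simpa [m, w, a'] using h3

lemma linTerm_smul (α : ASp T n) (k : Ksp T n) (t : Fin T) (x : Fin n) (p θ : ℝ)
    (ω : Fin n → ℝ) : linTerm α k t x (p * θ) (p • ω) = p * linTerm α k t x θ ω := by
  simp only [linTerm, Pi.smul_apply, smul_eq_mul, mul_add, mul_sum, mul_assoc]

/-- By homogeneity, the minimal value of each state term of the Lagrangian is zero. -/
lemma LagrangeMin.state_eq_zero (h : LagrangeMin ℓ F φ α k c a b d) (t : Fin T) (x : Fin n) :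
    a t x + linTerm α k t x (c.1 t.castSucc x) (c.2.1 t x) = 0 := by
  have h0 := h.state_le t x (θ := 0) (ω := 0) (r := 0) (by simp)
  have h2 := h.state_le t x (persp_smul_le two_pos (h.1.1 t x))
  rw [linTerm_smul] at h2
  have : linTerm α k t x 0 0 = 0 := by simp [linTerm]
  linarith

lemma LagrangeMin.le_cost (h : LagrangeMin ℓ F φ α k c a b d) (t : Fin T) (x : Fin n)
    {ρ : Fin n → ℝ} {r : ℝ} (hr : ℓ t x ρ ≤ r) :
    k.1 t.castSucc x ≤
      r + k.2.1 t.castSucc x + ∑ y, ρ y * (α t x y * k.2.2 t + k.1 t.succ y) := by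
  have h1 := h.state_le t x (θ := 1) (ω := ρ) (r := r) (by
    rw [persp_of_pos one_pos]
    simpa using hr)
  rw [h.state_eq_zero, linTerm] at h1
  linarith

lemma LagrangeMin.mem_subdiffFn (h : LagrangeMin ℓ F φ α k c a b d)
    (hF : ∀ s x, F s x ≠ ⊥) (hd : ∀ s, F s (c.2.2.1 s) = (d s : EReal)) (s : Fin (T + 1)) :
    k.2.1 s ∈ subdiffFn (F s) (c.2.2.1 s) := by
  refine ⟨hd s ▸ EReal.coe_ne_top _, fun x' => ?_⟩
  by_cases htop : F s x' = ⊤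
  · simp [htop]
  have := h.congestion_le s (EReal.coe_toReal htop (hF s x')).ge
  rw [hd, ← EReal.coe_toReal htop (hF s x'), ← EReal.coe_add, EReal.coe_le_coe_iff]
  simp only [mul_sub, sum_sub_distrib]
  linarith

lemma LagrangeMin.mem_subdiffR (h : LagrangeMin ℓ F φ α k c a b d)
    (hφ : ∀ t x, φ t x ≠ ⊥) (hb : ∀ t, φ t (c.2.2.2 t) = (b t : EReal)) (t : Fin T) :
    k.2.2 t ∈ subdiffR (φ t) (c.2.2.2 t) := by
  refine ⟨hb t ▸ EReal.coe_ne_top _, fun x' => ?_⟩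
  by_cases htop : φ t x' = ⊤
  · simp [htop]
  have := h.price_le t (EReal.coe_toReal htop (hφ t x')).ge
  rw [hb, ← EReal.coe_toReal htop (hφ t x'), ← EReal.coe_add, EReal.coe_le_coe_iff]
  linarith

end LagrangeMin

section DynamicProgramming

variable {ℓ : LSp T n} {α : ASp T n} {γ : Msp T n} {P : Psp T} {u : Msp T n}

lemma IsDP.dpCost_eq (h : IsDP ℓ α γ P u) (t : Fin T) (x : Fin n) :
    dpCost ℓ α u P t x = ((γ t.castSucc x - u t.castSucc x : ℝ) : EReal) := by
  have := h.1 t x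
  generalize dpCost ℓ α u P t x = z at this
  induction z with
  | bot => simp at this
  | top => simp at this
  | coe z =>
    rw [← EReal.coe_add, EReal.coe_eq_coe_iff] at this
    rw [EReal.coe_eq_coe_iff]
    linarith

lemma IsDP.le_cost (h : IsDP ℓ α γ P u) (t : Fin T) (x : Fin n) {ρ : Fin n → ℝ} {r : ℝ}
    (hr : ℓ t x ρ ≤ r) :
    u t.castSucc x ≤ r + γ t.castSucc x + ∑ y, ρ y * (α t x y * P t + u t.succ y) := by
  have h1 : ((∑ y, ρ y * -(α t x y * P t + u t.succ y) : ℝ) : EReal) - ℓ t x ρ ≤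
      dpCost ℓ α u P t x :=
    le_iSup (fun ρ : Fin n → ℝ =>
      ((∑ y, ρ y * -(α t x y * P t + u t.succ y) : ℝ) : EReal) - ℓ t x ρ) ρ
  have h2 := (EReal.sub_le_sub le_rfl hr).trans h1
  rw [h.dpCost_eq, ← EReal.coe_sub, EReal.coe_le_coe_iff] at h2
  simp only [mul_neg, sum_neg_distrib] at h2
  linarith

lemma IsDP.ge_of_forall_le_cost (h : IsDP ℓ α γ P u) {t : Fin T} {x : Fin n}
    (hbot : ∀ ρ, ℓ t x ρ ≠ ⊥) {q : ℝ}
    (hq : ∀ (ρ : Fin n → ℝ) (r : ℝ), ℓ t x ρ = r →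
      q ≤ r + γ t.castSucc x + ∑ y, ρ y * (α t x y * P t + u t.succ y)) :
    q ≤ u t.castSucc x := by
  have h1 : dpCost ℓ α u P t x ≤ ((γ t.castSucc x - q : ℝ) : EReal) := by
    refine iSup_le fun ρ => ?_
    by_cases htop : ℓ t x ρ = ⊤
    · simp [htop]
    have := hq ρ _ (EReal.coe_toReal htop (hbot ρ)).symm
    rw [← EReal.coe_toReal htop (hbot ρ), ← EReal.coe_sub, EReal.coe_le_coe_iff]
    simp only [mul_neg, sum_neg_distrib]
    linarith
  rw [h.dpCost_eq, EReal.coe_le_coe_iff] at h1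
  linarith

lemma IsDP.mfgi (h : IsDP ℓ α γ P u) (hprop : ∀ t x, EProper (ℓ t x))
    (hdom : ∀ t x ρ, ℓ t x ρ ≠ ⊤ → ρ ∈ simplex n) : MFGi ℓ α γ P u := by
  refine ⟨fun t x => le_antisymm (le_iInf₂ fun ρ _ => ?_) ?_, h.2⟩
  · by_cases htop : ℓ t x ρ = ⊤
    · simp [htop]
    have he := EReal.coe_toReal htop ((hprop t x).2 ρ)
    have := h.le_cost t x he.ge
    rwa [← he, ← EReal.coe_add, ← EReal.coe_add, EReal.coe_le_coe_iff]
  · set I := ⨅ ρ ∈ simplex n,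
      ℓ t x ρ + ↑(γ t.castSucc x) + ↑(∑ y, ρ y * (α t x y * P t + u t.succ y)) with hI
    have hle : ∀ (ρ : Fin n → ℝ) (r : ℝ), ℓ t x ρ = r → I ≤
        ((r + γ t.castSucc x + ∑ y, ρ y * (α t x y * P t + u t.succ y) : ℝ) : EReal) := by
      intro ρ r hr
      rw [EReal.coe_add, EReal.coe_add, ← hr]
      exact iInf₂_le ρ (hdom t x ρ (hr ▸ EReal.coe_ne_top r))
    clear_value I
    induction I with
    | bot => exact bot_le
    | top =>
      obtain ⟨ρ, hρ⟩ := (hprop t x).1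
      have := hle ρ _ (EReal.coe_toReal hρ ((hprop t x).2 ρ)).symm
      exact absurd (top_le_iff.1 this) (EReal.coe_ne_top _)
    | coe q =>
      rw [EReal.coe_le_coe_iff]
      exact h.ge_of_forall_le_cost (hprop t x).2
        fun ρ r hr => EReal.coe_le_coe_iff.1 (hle ρ r hr)

lemma IsDP.state_nonneg (h : IsDP ℓ α γ P u) {t : Fin T} {x : Fin n} {θ r : ℝ}
    {ω : Fin n → ℝ} (hr : persp (ℓ t x) θ ω ≤ r) :
    0 ≤ r + linTerm α (u, γ, P) t x θ ω := by
  rcases pos_or_zero_of_persp_ne_top (ne_top_of_le_ne_top (EReal.coe_ne_top r) hr) with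
    hθ | ⟨rfl, rfl⟩
  · rw [persp_of_pos hθ, coe_mul_le_coe_iff hθ] at hr
    have h1 : 0 ≤ r / θ + linTerm α (u, γ, P) t x 1 (θ⁻¹ • ω) := by
      have := h.le_cost t x hr
      simp only [linTerm]
      linarith
    have h2 := mul_nonneg hθ.le h1
    rwa [mul_add, mul_div_cancel₀ _ hθ.ne', ← linTerm_smul, mul_one, smul_inv_smul₀ hθ.ne'] at h2
  · rw [persp_zero] at hr
    simpa [linTerm] using EReal.coe_nonneg.1 hr

end DynamicProgramming

section Optimality

variable {ℓ : LSp T n} {F : FSp T n} {φ : PhiSp T} {α : ASp T n} {k : Ksp T n} {c : Csp T n}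
  {a : Fin T → Fin n → ℝ} {b : Fin T → ℝ} {d : Fin (T + 1) → ℝ} {u : Msp T n}

lemma LagrangeMin.le_dp (h : LagrangeMin ℓ F φ α k c a b d) (hdp : IsDP ℓ α k.2.1 k.2.2 u)
    (hbot : ∀ t x ρ, ℓ t x ρ ≠ ⊥) (hdom : ∀ t x ρ, ℓ t x ρ ≠ ⊤ → ρ ∈ simplex n)
    (s : Fin (T + 1)) : ∀ x, k.1 s x ≤ u s x := by
  induction s using Fin.reverseInduction with
  | last => exact fun x => by rw [h.terminal_eq, hdp.2]
  | cast t ih =>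
    refine fun x => hdp.ge_of_forall_le_cost (hbot t x) fun ρ r hr => ?_
    have hρ := (hdom t x ρ (hr ▸ EReal.coe_ne_top r)).1
    refine (h.le_cost t x hr.le).trans ?_
    gcongr with y
    · exact (hρ y).1
    · exact ih y

/-- The state terms also vanish when the dual variable is replaced by the value function. -/
lemma LagrangeMin.dp_state_eq_zero (h : LagrangeMin ℓ F φ α k c a b d)
    (hdp : IsDP ℓ α k.2.1 k.2.2 u) (hbot : ∀ t x ρ, ℓ t x ρ ≠ ⊥)
    (hdom : ∀ t x ρ, ℓ t x ρ ≠ ⊤ → ρ ∈ simplex n) {m0 : Fin n → ℝ} (hm0 : ∀ x, 0 ≤ m0 x)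
    (hc : Aop α c + rhs m0 = 0) (t : Fin T) (x : Fin n) :
    a t x + linTerm α (u, k.2.1, k.2.2) t x (c.1 t.castSucc x) (c.2.1 t x) = 0 := by
  have hz : ∀ k' : Ksp T n, linSum α k' c + ∑ x, m0 x * k'.1 0 x = 0 := fun k' => by
    rw [← kpair_Aop, ← kpair_rhs, ← kpair_add, hc]
    simp [kpair]
  have h1 := hz k
  have h2 := hz (u, k.2.1, k.2.2)
  have hu : ∑ x, m0 x * k.1 0 x ≤ ∑ x, m0 x * u 0 x :=
    sum_le_sum fun x _ => mul_le_mul_of_nonneg_left (h.le_dp hdp hbot hdom 0 x) (hm0 x)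
  have hk : ∑ t, ∑ x, (a t x + linTerm α k t x (c.1 t.castSucc x) (c.2.1 t x)) = 0 :=
    sum_eq_zero fun t _ => sum_eq_zero fun x _ => h.state_eq_zero t x
  have hnn : ∀ t x,
      0 ≤ a t x + linTerm α (u, k.2.1, k.2.2) t x (c.1 t.castSucc x) (c.2.1 t x) :=
    fun t x => hdp.state_nonneg (h.1.1 t x)
  have hle : ∑ t, ∑ x,
      (a t x + linTerm α (u, k.2.1, k.2.2) t x (c.1 t.castSucc x) (c.2.1 t x)) ≤ 0 := by
    simp only [linSum, h.terminal_eq, hdp.2, sub_self, mul_zero, sum_const_zero] at h1 h2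
    simp only [sum_add_distrib] at hk ⊢
    linarith
  have h3 := (sum_eq_zero_iff_of_nonneg fun t _ => sum_nonneg fun x _ => hnn t x).1
    (le_antisymm hle (sum_nonneg fun t _ => sum_nonneg fun x _ => hnn t x)) t (mem_univ t)
  exact (sum_eq_zero_iff_of_nonneg fun x _ => hnn t x).1 h3 x (mem_univ x)

end Optimality

/-- Proposition 2: from solutions `(m₁,w,m₂,D)` of (𝔓) and
`(u,γ,P)` of (𝔇), with `û = U[γ,P]` and `π ∈ 𝛑[m₁,w,û,γ,P]`, one obtains a
solution `(m₁,π,û,γ,P)` of the MFG system. -/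
theorem potential_to_mfg {T n : ℕ} (hT : 1 ≤ T) (hn : 1 ≤ n)
    (ℓ : LSp T n) (F : FSp T n) (φ : PhiSp T) (α : ASp T n)
    (m0 : Fin n → ℝ) (hm0 : m0 ∈ simplex n)
    (hconv : ConvAssumption ℓ F φ) (hqual : Qualif ℓ F φ α m0)
    (c : Csp T n) (k : Ksp T n)
    (hsolP : IsSolPfrak ℓ F φ α m0 c) (hsolD : IsSolDfrak ℓ F φ α m0 k)
    (uh : Msp T n) (hdp : IsDP ℓ α k.2.1 k.2.2 uh)
    (π : Wsp T n) (hπ : InPiSet ℓ α c.1 c.2.1 uh k.2.2 π) :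
    IsMFGSol ℓ F φ α m0 c.1 π uh k.2.1 k.2.2 := by
  have hprop := fun t x => (hconv.1 t x).1
  have hdom := fun t x => (hconv.1 t x).2.2.2
  obtain ⟨hc0, hctop⟩ := feasible_and_fobj_ne_top_of_solution hconv hqual hsolP
  obtain ⟨a, b, d, ha, hb, hd, hv⟩ := exists_terms_eq hconv hctop
  have hmin : LagrangeMin ℓ F φ α k c a b d := by
    refine ⟨⟨fun t x => (ha t x).le, fun t => (hb t).le, fun s => (hd s).le⟩,
      fun c' a' b' d' h' => ?_⟩
    have h1 := lagrangian_minimal hconv hqual hsolP hsolD hv h'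
    have h2 : kpair k (Aop α c + rhs m0) = 0 := by rw [hc0]; simp [kpair]
    rw [kpair_add, kpair_Aop] at h1 h2
    linarith
  have hm2 : c.2.2.1 = c.1 := by
    funext s x
    have := congrFun (congrFun (congrArg (fun e : Ksp T n => e.2.1) hc0) s) x
    simp only [Aop, rhs, Prod.snd_add, Prod.fst_add, Pi.add_apply, Prod.snd_zero,
      Prod.fst_zero, Pi.zero_apply] at this
    linarith
  have hsign : ∀ t x, 0 < c.1 t.castSucc x ∨ c.1 t.castSucc x = 0 ∧ c.2.1 t x = 0 :=
    fun t x => pos_or_zero_of_persp_ne_top (ha t x ▸ EReal.coe_ne_top _)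
  have hw : ∀ t x y, c.2.1 t x y = c.1 t.castSucc x * π t x y := by
    intro t x y
    rcases hsign t x with h | h
    · rw [(hπ.2 t x).1 h, mul_div_cancel₀ _ h.ne']
    · simp [h.1, h.2]
  have hD : ∀ t, c.2.2.2 t = Qcpl α c.1 π t := by
    intro t
    have := congrFun (congrArg (fun e : Ksp T n => e.2.2) hc0) t
    simp only [Aop, rhs, Prod.snd_add, Pi.add_apply, Prod.snd_zero, Pi.zero_apply, opA,
      hw] at this
    simp only [Qcpl]
    linarith
  have hs1 : ∀ s x, opS c.2.1 s x - c.1 s x + mbar0 m0 s x = 0 := fun s x =>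
    congrFun (congrFun (congrArg (fun e : Ksp T n => e.1) hc0) s) x
  have hi : MFGi ℓ α k.2.1 k.2.2 uh := hdp.mfgi hprop hdom
  refine ⟨hπ.1, hi, fun t x => ?_, ⟨fun x => ?_, fun t x => ?_⟩, fun s => ?_, fun t => ?_⟩
  · rcases hsign t x with h | h
    · have h0 := hmin.dp_state_eq_zero hdp (fun t x => (hprop t x).2) hdom
        (fun x => (hm0.1 x).1) hc0 t x
      have hωπ : c.2.1 t x = c.1 t.castSucc x • π t x := funext (hw t x)
      have hℓ := ha t x
      rw [hωπ, persp_of_pos h, inv_smul_smul₀ h.ne'] at hℓ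
      have hle := (coe_mul_le_coe_iff h _).1 hℓ.le
      have htop := ne_top_of_le_ne_top (EReal.coe_ne_top _) hle
      obtain ⟨r, hr⟩ : ∃ r : ℝ, ℓ t x (π t x) = r :=
        ⟨_, (EReal.coe_toReal htop ((hprop t x).2 _)).symm⟩
      rw [hr, ← EReal.coe_mul, EReal.coe_eq_coe_iff] at hℓ
      have hlin := linTerm_smul α (uh, k.2.1, k.2.2) t x (c.1 t.castSucc x) 1 (π t x)
      rw [mul_one, ← hωπ] at hlin
      rw [hlin, ← hℓ, ← mul_add] at h0
      have h1 := (mul_eq_zero.1 h0).resolve_left h.ne'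
      rw [hr, ← EReal.coe_add, ← EReal.coe_add, EReal.coe_eq_coe_iff]
      simp only [linTerm] at h1
      linarith
    · rw [hi.1 t x]
      refine le_antisymm (le_iInf₂ fun ρ hρ => ?_) (iInf₂_le _ (hπ.1 t x))
      have := add_le_add ((hπ.2 t x).2 h.1 ρ hρ) (le_refl (k.2.1 t.castSucc x : EReal))
      simp only [mul_comm (k.2.2 t)] at this
      rwa [add_right_comm, add_right_comm (ℓ t x ρ)]
  · have := hs1 0 x
    simp only [opS_zero, mbar0_zero] at this
    linarith
  · have := hs1 t.succ x
    simp only [opS_succ, mbar0_succ, hw] at this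
    linarith
  · have := hmin.mem_subdiffFn (fun s => (hconv.2.1 s).1.2) hd s
    rwa [hm2] at this
  · have := hmin.mem_subdiffR (fun t => (hconv.2.2 t).1.2) hb t
    rwa [hD] at this

end
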